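/- arXiv:2308.02753 — 2 statements merged into one kernel-verified Lean document; each statement's English description precedes it below -/
import Mathlib

section
/- Let n, B, M be positive natural numbers, let θ ∈ ℝⁿ (Euclidean space), let η ≥ 0 be a real number, let ℓ_i : ℝⁿ → ℝ for i ∈ Fin B be differentiable at θ, let g_j : ℝⁿ → ℝ for j ∈ Fin M, let σ : ℝ → ℝ be the logistic sigmoid σ(t) = (1 + exp(−t))⁻¹, define θ̂ : ℝ^B → ℝⁿ by θ̂(w) = θ − (η/B) · Σ_{i∈Fin B} σ(w_i) · ∇ℓ_i(θ), and define L_M : ℝⁿ → ℝ by L_M(θ') = (1/M) · Σ_{j∈Fin M} g_j(θ'). If each g_j is differentiable at θ̂(w), then for every i ∈ Fin B the absolute value of the partial derivative of w ↦ L_M(θ̂(w)) with respect to the coordinate w_i, evaluated at w, is at most (η/(4B)) · ‖(1/M) · Σ_{j∈Fin M} ∇g_j(θ̂(w))‖ · ‖∇ℓ_i(θ)‖. In particular, if the average gradient of the validation losses at θ̂(w) is the zero vector, then all these partial derivatives vanish (training guidance vanishment). -/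
open scoped RealInnerProductSpace BigOperators

/-- The derivative of the sigmoid is at most `1 / 4`. -/
theorem sigmoid_mul_one_sub_le (t : ℝ) : Real.sigmoid t * (1 - Real.sigmoid t) ≤ 1 / 4 := by
  nlinarith [sq_nonneg (Real.sigmoid t - 1 / 2)]

theorem abs_sigmoid_mul_one_sub_le (t : ℝ) :
    |Real.sigmoid t * (1 - Real.sigmoid t)| ≤ 1 / 4 := by
  rw [abs_of_nonneg (mul_nonneg (Real.sigmoid_nonneg t) (sub_nonneg.2 (Real.sigmoid_le_one t)))]
  exact sigmoid_mul_one_sub_le t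

/-- The gradient of a scaled finite sum is the scaled sum of the gradients. -/
theorem hasGradientAt_const_mul_sum {ι F : Type*} [Fintype ι] [NormedAddCommGroup F]
    [InnerProductSpace ℝ F] [CompleteSpace F] {g : ι → F → ℝ} {x : F} (c : ℝ)
    (hg : ∀ j, DifferentiableAt ℝ (g j) x) :
    HasGradientAt (fun y => c * ∑ j, g j y) (c • ∑ j, gradient (g j) x) x := by
  rw [hasGradientAt_iff_hasFDerivAt, map_smul, map_sum]
  exact (HasFDerivAt.fun_sum fun j _ => (hg j).hasGradientAt.hasFDerivAt).const_mul c

/-- Chain rule along a curve, in terms of the gradient. -/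
theorem HasGradientAt.comp_hasDerivAt_inner {F : Type*} [NormedAddCommGroup F]
    [InnerProductSpace ℝ F] [CompleteSpace F] {f : F → ℝ} {γ : ℝ → F} {f' γ' : F} {t : ℝ}
    (hf : HasGradientAt f f' (γ t)) (hγ : HasDerivAt γ γ' t) :
    HasDerivAt (fun s => f (γ s)) (inner ℝ f' γ') t :=
  hf.hasFDerivAt.comp_hasDerivAt t hγ

/-- Derivative of a sum of weighted vectors in a single weight. -/
theorem hasDerivAt_sum_update_smul {ι F : Type*} [Fintype ι] [DecidableEq ι]
    [NormedAddCommGroup F] [NormedSpace ℝ F] {φ : ℝ → ℝ} {φ' : ℝ} (w : ι → ℝ) (v : ι → F) (i : ι)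
    (hφ : HasDerivAt φ φ' (w i)) :
    HasDerivAt (fun t => ∑ k, φ (Function.update w i t k) • v k) (φ' • v i) (w i) := by
  have hterm : ∀ k ∈ Finset.univ, HasDerivAt (fun t => φ (Function.update w i t k) • v k)
      (if k = i then φ' • v i else 0) (w i) := by
    intro k _
    by_cases hk : k = i
    · subst hk
      simpa using hφ.smul_const (v k)
    · simpa [hk] using hasDerivAt_const (w i) (φ (w k) • v k)
  simpa using HasDerivAt.fun_sum hterm

/-- **Training guidance vanishment (DaMSTF, §4.1).** The absolute value of the partial
derivative of each instance weight on the meta validation loss is bounded by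
`(η / (4B)) · ‖avg validation gradient‖ · ‖training gradient‖`; in particular, all these
partial derivatives vanish when the averaged gradient on the meta validation set is zero. -/
theorem training_guidance_vanishment
    (n B M : ℕ) (hn : 0 < n) (hB : 0 < B) (hM : 0 < M)
    (θ : EuclideanSpace ℝ (Fin n)) (η : ℝ) (hη : 0 ≤ η)
    (ℓ : Fin B → EuclideanSpace ℝ (Fin n) → ℝ)
    (g : Fin M → EuclideanSpace ℝ (Fin n) → ℝ)
    (hℓ : ∀ i, DifferentiableAt ℝ (ℓ i) θ)
    (σ : ℝ → ℝ) (hσ : ∀ t, σ t = (1 + Real.exp (-t))⁻¹)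
    (θHat : (Fin B → ℝ) → EuclideanSpace ℝ (Fin n))
    (hθHat : ∀ w : Fin B → ℝ,
      θHat w = θ - (η / B) • ∑ i : Fin B, σ (w i) • gradient (ℓ i) θ)
    (LM : EuclideanSpace ℝ (Fin n) → ℝ)
    (hLM : ∀ θ', LM θ' = (1 / M : ℝ) * ∑ j : Fin M, g j θ')
    (w : Fin B → ℝ)
    (hg : ∀ j, DifferentiableAt ℝ (g j) (θHat w)) :
    (∀ i : Fin B,
      |deriv (fun t : ℝ => LM (θHat (Function.update w i t))) (w i)| ≤
        (η / (4 * B)) * ‖(1 / M : ℝ) • ∑ j : Fin M, gradient (g j) (θHat w)‖ *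
          ‖gradient (ℓ i) θ‖) ∧
    ((1 / M : ℝ) • ∑ j : Fin M, gradient (g j) (θHat w) = 0 →
      ∀ i : Fin B,
        deriv (fun t : ℝ => LM (θHat (Function.update w i t))) (w i) = 0) := by
  obtain rfl : σ = Real.sigmoid := funext hσ
  obtain rfl : LM = fun θ' => (1 / M : ℝ) * ∑ j : Fin M, g j θ' := funext hLM
  have bound : ∀ i : Fin B,
      |deriv (fun t : ℝ => (1 / M : ℝ) * ∑ j : Fin M, g j (θHat (Function.update w i t))) (w i)| ≤
        (η / (4 * B)) * ‖(1 / M : ℝ) • ∑ j : Fin M, gradient (g j) (θHat w)‖ *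
          ‖gradient (ℓ i) θ‖ := by
    intro i
    set G := (1 / M : ℝ) • ∑ j : Fin M, gradient (g j) (θHat w)
    have hcurve : HasDerivAt (fun t => θHat (Function.update w i t))
        (-((η / B) • (Real.sigmoid (w i) * (1 - Real.sigmoid (w i))) • gradient (ℓ i) θ))
        (w i) := by
      simp only [hθHat]
      exact ((hasDerivAt_sum_update_smul w (fun k => gradient (ℓ k) θ) i
        (Real.hasDerivAt_sigmoid (w i))).const_smul (η / B : ℝ)).const_sub θ
    have hgrad : HasGradientAt (fun y => (1 / M : ℝ) * ∑ j, g j y) G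
        (θHat (Function.update w i (w i))) := by
      rw [Function.update_eq_self]
      exact hasGradientAt_const_mul_sum _ hg
    rw [(hgrad.comp_hasDerivAt_inner hcurve).deriv]
    refine (abs_real_inner_le_norm _ _).trans ?_
    rw [norm_neg, norm_smul (η / B : ℝ), norm_smul (_ * _ : ℝ),
      Real.norm_of_nonneg (by positivity : 0 ≤ η / B),
      Real.norm_eq_abs]
    calc ‖G‖ * (η / B * (|Real.sigmoid (w i) * (1 - Real.sigmoid (w i))| * ‖gradient (ℓ i) θ‖))
        ≤ ‖G‖ * (η / B * (1 / 4 * ‖gradient (ℓ i) θ‖)) := by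
          gcongr
          exact abs_sigmoid_mul_one_sub_le (w i)
      _ = η / (4 * B) * ‖G‖ * ‖gradient (ℓ i) θ‖ := by
          field_simp
  refine ⟨bound, fun hzero i => ?_⟩
  have hi := bound i
  rw [hzero, norm_zero, mul_zero, zero_mul] at hi
  exact abs_nonpos_iff.1 hi
end

section
/- Let X be a type, let S and T be nonempty finite sets of elements of X, and let h, h*, y_S, y_T : X → Bool be binary hypotheses, where y_S and y_T are arbitrary labeling functions on S and T respectively. Then ε_T(h, y_T) ≤ ε_S(h, y_S) + (1/2) · d(S, T) + ε_T(h*, y_T) + ε_S(h*, y_S). -/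
/-- Disagreement of two binary hypotheses on a finite dataset: the fraction of instances on
which they differ (0 if the dataset is empty, by the division-by-zero convention). -/
noncomputable def disag {X : Type*} (S : Finset X) (h₁ h₂ : X → Bool) : ℝ :=
  ((S.filter fun x => h₁ x ≠ h₂ x).card : ℝ) / (S.card : ℝ)

/-- The HΔH-distance between two finite datasets, with hypothesis class all functions
`X → Bool`: twice the supremum of the gaps of disagreements. -/
noncomputable def dHH {X : Type*} (S T : Finset X) : ℝ :=
  2 * sSup {r : ℝ | ∃ h₁ h₂ : X → Bool, r = |disag S h₁ h₂ - disag T h₁ h₂|}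

theorem disag_comm {X : Type*} (S : Finset X) (h₁ h₂ : X → Bool) :
    disag S h₁ h₂ = disag S h₂ h₁ := by
  simp only [disag, ne_comm]

theorem disag_nonneg {X : Type*} (S : Finset X) (h₁ h₂ : X → Bool) : 0 ≤ disag S h₁ h₂ := by
  unfold disag
  positivity

theorem disag_le_one {X : Type*} (S : Finset X) (h₁ h₂ : X → Bool) : disag S h₁ h₂ ≤ 1 :=
  div_le_one_of_le₀ (mod_cast Finset.card_filter_le _ _) (Nat.cast_nonneg _)

theorem disag_triangle {X : Type*} (S : Finset X) (h₁ h₂ h₃ : X → Bool) :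
    disag S h₁ h₃ ≤ disag S h₁ h₂ + disag S h₂ h₃ := by
  classical
  unfold disag
  rw [← add_div]
  gcongr
  norm_cast
  refine (Finset.card_le_card fun x hx => ?_).trans (Finset.card_union_le _ _)
  simp only [Finset.mem_union, Finset.mem_filter] at hx ⊢
  grind

theorem abs_disag_sub_disag_le_half_dHH {X : Type*} (S T : Finset X) (h₁ h₂ : X → Bool) :
    |disag S h₁ h₂ - disag T h₁ h₂| ≤ (1 / 2) * dHH S T := by
  have hbdd : BddAbove {r : ℝ | ∃ h₁ h₂ : X → Bool, r = |disag S h₁ h₂ - disag T h₁ h₂|} := by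
    refine ⟨1, ?_⟩
    rintro _ ⟨g₁, g₂, rfl⟩
    exact abs_sub_le_of_nonneg_of_le (disag_nonneg S g₁ g₂) (disag_le_one S g₁ g₂)
      (disag_nonneg T g₁ g₂) (disag_le_one T g₁ g₂)
  have hle := le_csSup hbdd ⟨h₁, h₂, rfl⟩
  unfold dHH
  linarith

/-- **Finite-sample domain adaptation bound (Ben-David et al., as used in the proof of
Theorem 2 of DaMSTF).** The error of `h` on the target set `T` (labeled by `y_T`) is bounded
by its error on the source set `S` (labeled by `y_S`), half the HΔH-distance between `S` and
`T`, and the combined error of a reference hypothesis `h*` on both labeled sets. -/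
theorem ben_david_bound {X : Type*}
    (S T : Finset X) (hS : S.Nonempty) (hT : T.Nonempty)
    (h hstar yS yT : X → Bool) :
    disag T h yT ≤
      disag S h yS + (1 / 2) * dHH S T + disag T hstar yT + disag S hstar yS := by
  have hT_tri := disag_triangle T h hstar yT
  have hS_tri := disag_triangle S h yS hstar
  have hcomm := disag_comm S yS hstar
  have hgap := abs_le.mp (abs_disag_sub_disag_le_half_dHH S T h hstar)
  linarith [hgap.1]
end
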